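/- Let M₀ ≺ H_{θ₀} and M₁ ≺ H_{θ₁} with the structures ⟨M₀ ∩ θ₀, P(θ₀) ∩ M₀, ∈⟩ and ⟨M₁ ∩ θ₁, P(θ₁) ∩ M₁, ∈⟩ isomorphic. Then ⟨M₀, ∈⟩ and ⟨M₁, ∈⟩ are isomorphic structures. -/

import Mathlib

open Cardinal

namespace GuessingModels

/-- First-order formulas in the language of set theory (membership and equality),
with `n` free variables. -/
inductive SF : ℕ → Type
  | mem {n} (i j : Fin n) : SF n
  | eq {n} (i j : Fin n) : SF n
  | imp {n} (f g : SF n) : SF n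
  | not {n} (f : SF n) : SF n
  | ex {n} (f : SF (n + 1)) : SF n

/-- Tarskian satisfaction of a set-theoretic formula in the structure `⟨S, ∈⟩`,
where `S` is a class of ZF sets. -/
def Realize (S : Set ZFSet) : ∀ {n}, SF n → (Fin n → ZFSet) → Prop
  | _, .mem i j, v => v i ∈ v j
  | _, .eq i j, v => v i = v j
  | _, .imp f g, v => Realize S f v → Realize S g v
  | _, .not f, v => ¬ Realize S f v
  | _, .ex f, v => ∃ x ∈ S, Realize S f (Fin.cons x v)

/-- `M ≺ R` : `M` is an elementary substructure of `⟨R, ∈⟩`. -/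
def Prec (M R : Set ZFSet) : Prop :=
  M ⊆ R ∧ ∀ {n : ℕ} (φ : SF n) (v : Fin n → ZFSet), (∀ i, v i ∈ M) →
    (Realize M φ v ↔ Realize R φ v)

/-- A (von Neumann) ordinal: a transitive set of transitive sets. -/
def IsOrd (x : ZFSet) : Prop :=
  x.IsTransitive ∧ ∀ y ∈ x, ZFSet.IsTransitive y

/-- `≤` on ordinals, i.e. `∈` or `=`. -/
def ole (a b : ZFSet) : Prop := a ∈ b ∨ a = b

/-- The cardinality of (the extension of) a ZF set. -/
noncomputable def card (x : ZFSet) : Cardinal := Cardinal.mk x.toSet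

/-- A ZF set which is a cardinal: an ordinal not equinumerous with any of its members. -/
def IsCard (κ : ZFSet) : Prop := IsOrd κ ∧ ∀ β ∈ κ, card β < card κ

/-- `s` (an external class) is a cofinal subset of the ordinal `κ`. -/
def CofinalSetIn (s : Set ZFSet) (κ : ZFSet) : Prop :=
  (∀ x ∈ s, x ∈ κ) ∧ ∀ β ∈ κ, ∃ γ ∈ s, ole β γ

/-- A regular cardinal: an infinite cardinal all of whose cofinal subsets have full size. -/
def IsRegCard (κ : ZFSet) : Prop :=
  IsCard κ ∧ ZFSet.omega ⊆ κ ∧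
    ∀ s : Set ZFSet, CofinalSetIn s κ → Cardinal.mk s = card κ

/-- A strong limit ZF cardinal. -/
def IsStrongLimit (κ : ZFSet) : Prop := ∀ β ∈ κ, (2 : Cardinal) ^ card β < card κ

/-- A strongly inaccessible cardinal: regular, uncountable and strong limit. -/
def IsInacc (κ : ZFSet) : Prop := IsRegCard κ ∧ ZFSet.omega ∈ κ ∧ IsStrongLimit κ

/-- The transitive closure of a ZF set, as a class. -/
def tcl (x : ZFSet) : Set ZFSet := {y | Relation.TransGen (· ∈ ·) y x}

/-- `H_θ` : the class of sets hereditarily of size `< θ`. -/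
noncomputable def HSet (θ : ZFSet) : Set ZFSet := {x | Cardinal.mk (tcl x) < card θ}

/-- `V_α` as a class, for `α` an ordinal (as a ZF set): sets of rank `< α`. -/
noncomputable def VSet (α : ZFSet) : Set ZFSet := {x | x.rank < α.rank}

/-- A suitable initial segment: `H_θ` for a regular cardinal `θ`, or a rank initial
segment `V_α`. -/
def Suitable (R : Set ZFSet) : Prop :=
  (∃ θ : ZFSet, IsRegCard θ ∧ R = HSet θ) ∨ (∃ α : ZFSet, IsOrd α ∧ R = VSet α)

/-- `κ = κ_M` : `κ` is the least ordinal in `M` with `M ∩ κ ≠ κ`. -/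
def KappaSpec (M : Set ZFSet) (κ : ZFSet) : Prop :=
  IsOrd κ ∧ κ ∈ M ∧ (∃ β ∈ κ, β ∉ M) ∧
    ∀ α : ZFSet, IsOrd α → α ∈ M → (∃ β ∈ α, β ∉ M) → ole κ α

/-- `d` is `(δ, M)`-approximated: `d ∩ Z ∈ M` for every `Z ∈ M` of size `< δ`. -/
noncomputable def Approx (M : Set ZFSet) (δ : Cardinal.{1}) (d : ZFSet) : Prop :=
  ∀ Z : ZFSet, Z ∈ M → card Z < δ → (d ∩ Z) ∈ M

/-- `d ⊆ X` is `M`-guessed: `d ∩ M = e ∩ M` for some `e ∈ M ∩ P(X)`. -/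
def Guessed (M : Set ZFSet) (X d : ZFSet) : Prop :=
  ∃ e : ZFSet, e ∈ M ∧ e ⊆ X ∧ ∀ z ∈ M, (z ∈ e ↔ z ∈ d)

/-- `M` is a `δ`-guessing model: every `(δ,M)`-approximated subset of any `X ∈ M`
is `M`-guessed. -/
noncomputable def GuessingModel (M : Set ZFSet) (δ : Cardinal.{1}) : Prop :=
  ∀ X ∈ M, ∀ d : ZFSet, d ⊆ X → Approx M δ d → Guessed M X d

/-- `M` is `ℵ₁`-internally unbounded: every countable subset of `M` is contained
in a countable element of `M`. -/
noncomputable def IntUnb (M : Set ZFSet) : Prop :=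
  ∀ A : Set ZFSet, A ⊆ M → A.Countable → ∃ z ∈ M, card z ≤ ℵ₀ ∧ A ⊆ z.toSet
open Matrix (vecCons)

namespace SF

/-- Conjunction. -/
def and {n : ℕ} (f g : SF n) : SF n := .not (.imp f (.not g))

/-- Disjunction. -/
def or {n : ℕ} (f g : SF n) : SF n := .imp (.not f) g

/-- Universal quantification. -/
def all {n : ℕ} (f : SF (n + 1)) : SF n := .not (.ex (.not f))

/-- `∀ x ∈ a, f`. -/
def ball {n : ℕ} (a : Fin n) (f : SF (n + 1)) : SF n := all (.imp (.mem 0 a.succ) f)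

/-- `∃ x ∈ a, f`. -/
def bex {n : ℕ} (a : Fin n) (f : SF (n + 1)) : SF n := .ex (and (.mem 0 a.succ) f)

/-- `z = {a, b}`. -/
def upair {n : ℕ} (z a b : Fin n) : SF n :=
  and (.mem a z) (and (.mem b z) (ball z (or (.eq 0 a.succ) (.eq 0 b.succ))))

/-- `p = (a, b)`. -/
def opair {n : ℕ} (p a b : Fin n) : SF n :=
  .ex (.ex (and (upair 0 a.succ.succ a.succ.succ)
    (and (upair 1 a.succ.succ b.succ.succ) (upair p.succ.succ 0 1))))

/-- `(i, x) ∈ f`. -/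
def app {n : ℕ} (f i x : Fin n) : SF n := .ex (and (opair 0 i.succ x.succ) (.mem 0 f.succ))

/-- `((i, j), k) ∈ g`. -/
def val {n : ℕ} (g i j k : Fin n) : SF n :=
  .ex (and (opair 0 i.succ j.succ) (app g.succ 0 k.succ))

/-- There is `x` with `(i, x) ∈ f` and `φ x`. -/
def exApp {n : ℕ} (f i : Fin n) (φ : SF (n + 1)) : SF n := .ex (and (app f.succ i.succ 0) φ)

/-- All `x` with `(i, x) ∈ f` satisfy `φ x`. -/
def allApp {n : ℕ} (f i : Fin n) (φ : SF (n + 1)) : SF n := all (.imp (app f.succ i.succ 0) φ)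

/-- There is `k` with `((i, j), k) ∈ g` and `φ k`. -/
def exVal {n : ℕ} (g i j : Fin n) (φ : SF (n + 1)) : SF n :=
  .ex (and (val g.succ i.succ j.succ 0) φ)

/-- All `k` with `((i, j), k) ∈ g` satisfy `φ k`. -/
def allVal {n : ℕ} (g i j : Fin n) (φ : SF (n + 1)) : SF n :=
  all (.imp (val g.succ i.succ j.succ 0) φ)

/-- `(i', j')` is lexicographically below `(i, j)`. -/
def lexLT {n : ℕ} (i' j' i j : Fin n) : SF n := or (.mem i' i) (and (.eq i' i) (.mem j' j))

/-- `x` is an ordinal. -/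
def ord {n : ℕ} (x : Fin n) : SF n :=
  and (ball x (ball 0 (.mem 0 x.succ.succ))) (ball x (ball 0 (ball 0 (.mem 0 2))))

/-- The formula expressing `IsPairing`. -/
def pairing {n : ℕ} (β g : Fin n) : SF n :=
  ball β <| ball β.succ <|
    and (exVal g.succ.succ 1 0 (.eq 0 0)) <| allVal g.succ.succ 1 0 <|
      and (ball 0 <| bex β.succ.succ.succ.succ <| bex β.succ.succ.succ.succ.succ <|
          and (lexLT 1 0 5 4) (val g.succ.succ.succ.succ.succ.succ 1 0 2))
        (ball β.succ.succ.succ <| ball β.succ.succ.succ.succ <| .imp (lexLT 1 0 4 3) <|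
          bex 2 (val g.succ.succ.succ.succ.succ.succ 2 1 0))

/-- The formula expressing `CodeRel`. -/
def codeRel {n : ℕ} (g A i j : Fin n) : SF n := bex A (val g.succ i.succ j.succ 0)

/-- The formula expressing `IsDecoding`. -/
def decoding {n : ℕ} (β g A f : Fin n) : SF n :=
  ball β <| and (exApp f.succ 0 (.eq 0 0)) <| allApp f.succ 0 <|
    and (ball 0 <| bex β.succ.succ.succ <|
        and (codeRel g.succ.succ.succ.succ A.succ.succ.succ.succ 0 3)
          (app f.succ.succ.succ.succ 0 1))
      (ball β.succ.succ <| .imp (codeRel g.succ.succ.succ A.succ.succ.succ 0 2) <|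
        bex 1 (app f.succ.succ.succ.succ 1 0))

/-- Every nonempty subset of `β` has a minimal element for the relation coded by `g` and `A`. -/
def wf {n : ℕ} (β g A : Fin n) : SF n :=
  all <| .imp (ball 0 (.mem 0 β.succ.succ)) <| ball 0 <| bex 1 <| ball 2 <|
    .not (codeRel g.succ.succ.succ.succ A.succ.succ.succ.succ 0 1)

/-- Extensionality. -/
def extAx : SF 0 :=
  all <| all <| .imp (all (and (.imp (.mem 0 1) (.mem 0 2)) (.imp (.mem 0 2) (.mem 0 1)))) (.eq 0 1)

/-- `x` is a set of ordinals. -/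
def setOfOrds {n : ℕ} (x : Fin n) : SF n := ball x (ord 0)

/-- Every set is coded by a set of ordinals. -/
def codingAx : SF 0 :=
  all <| .ex <| .ex <| .ex <| .ex <|
    and (ord 3) <| and (pairing 3 2) <| and (setOfOrds 1) <| and (decoding 3 2 1 0) <|
      bex 3 (app 1 0 5)

/-- Pairing functions exist and well-founded codes can be decoded. -/
def decodingAx : SF 0 :=
  all <| all <| .imp (ord 1) <| .ex <|
    and (pairing 2 0) (.imp (wf 2 0 1) (.ex (decoding 3 1 2 0)))

end SF

/-- Membership in the graph of a function of two variables. -/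
def Val (g i j k : ZFSet) : Prop := ZFSet.pair (ZFSet.pair i j) k ∈ g

/-- Membership in the graph of a function. -/
def App (f i x : ZFSet) : Prop := ZFSet.pair i x ∈ f

/-- The lexicographic order on pairs. -/
def LexLT (i' j' i j : ZFSet) : Prop := i' ∈ i ∨ i' = i ∧ j' ∈ j

/-- `g` restricts to the Mostowski collapse of the lexicographic order on `β × β`. -/
def IsPairing (β g : ZFSet) : Prop :=
  ∀ i ∈ β, ∀ j ∈ β, (∃ k, Val g i j k) ∧ ∀ k, Val g i j k →
    (∀ y ∈ k, ∃ i' ∈ β, ∃ j' ∈ β, LexLT i' j' i j ∧ Val g i' j' y) ∧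
    ∀ i' ∈ β, ∀ j' ∈ β, LexLT i' j' i j → ∃ y ∈ k, Val g i' j' y

/-- The relation coded by `A` via the pairing `g`. -/
def CodeRel (g A i j : ZFSet) : Prop := ∃ k ∈ A, Val g i j k

/-- `f` restricts to the Mostowski collapse of the relation on `β` coded by `A`. -/
def IsDecoding (β g A f : ZFSet) : Prop :=
  ∀ j ∈ β, (∃ x, App f j x) ∧ ∀ x, App f j x →
    (∀ y ∈ x, ∃ i ∈ β, CodeRel g A i j ∧ App f i y) ∧
    ∀ i ∈ β, CodeRel g A i j → ∃ y ∈ x, App f i y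

/-- Satisfaction with an assignment bundled to take values in the structure. -/
def Sat (S : Set ZFSet) {n : ℕ} (φ : SF n) (w : Fin n → S) : Prop :=
  Realize S φ fun i => w i

section Sat

variable {S : Set ZFSet} {n : ℕ} (w : Fin n → S)

theorem sat_mem (i j : Fin n) : Sat S (.mem i j) w ↔ (w i : ZFSet) ∈ (w j : ZFSet) := Iff.rfl

theorem sat_eq (i j : Fin n) : Sat S (.eq i j) w ↔ (w i : ZFSet) = (w j : ZFSet) := Iff.rfl

theorem sat_imp (f g : SF n) : Sat S (.imp f g) w ↔ (Sat S f w → Sat S g w) := Iff.rfl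

theorem sat_not (f : SF n) : Sat S (.not f) w ↔ ¬ Sat S f w := Iff.rfl

theorem sat_ex (f : SF (n + 1)) : Sat S (.ex f) w ↔ ∃ x : S, Sat S f (vecCons x w) := by
  have key (x : S) : (fun i => ((vecCons x w i : S) : ZFSet)) =
      Fin.cons (x : ZFSet) fun i => w i := by
    funext i
    cases i using Fin.cases <;> rfl
  simp only [Sat, Realize, key, Subtype.exists, exists_prop]

theorem sat_and (f g : SF n) : Sat S (.and f g) w ↔ Sat S f w ∧ Sat S g w := by
  simp only [SF.and, sat_not, sat_imp]; tauto

theorem sat_or (f g : SF n) : Sat S (.or f g) w ↔ Sat S f w ∨ Sat S g w := by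
  simp only [SF.or, sat_not, sat_imp]; tauto

theorem sat_all (f : SF (n + 1)) : Sat S (.all f) w ↔ ∀ x : S, Sat S f (vecCons x w) := by
  simp only [SF.all, sat_not, sat_ex, not_exists, not_not]

theorem sat_lexLT (i' j' i j : Fin n) :
    Sat S (.lexLT i' j' i j) w ↔ LexLT (w i') (w j') (w i) (w j) := by
  simp only [SF.lexLT, sat_or, sat_and, sat_mem, sat_eq, LexLT]

theorem sat_extAx (w : Fin 0 → S) :
    Sat S .extAx w ↔ ∀ x y : S, (∀ z : S, (z : ZFSet) ∈ (x : ZFSet) ↔ (z : ZFSet) ∈ (y : ZFSet)) →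
      x = y := by
  simp only [SF.extAx, sat_all, sat_imp, sat_and, sat_mem, sat_eq, Matrix.cons_val, SetCoe.ext_iff]
  exact ⟨fun h x y hz => (h x y fun z => ⟨(hz z).2, (hz z).1⟩).symm,
    fun h x y hz => (h x y fun z => ⟨(hz z).2, (hz z).1⟩).symm⟩

theorem sat_ball (hS : ∀ x ∈ S, ∀ y ∈ x, y ∈ S) (a : Fin n) (f : SF (n + 1)) : Sat S (.ball a f) w ↔
    ∀ x, ∀ h : x ∈ (w a : ZFSet), Sat S f (vecCons ⟨x, hS _ (w a).2 _ h⟩ w) := by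
  simp only [SF.ball, sat_all, sat_imp, sat_mem, Matrix.cons_val_zero, Matrix.cons_val_succ]
  exact ⟨fun h x hx => h ⟨x, hS _ (w a).2 _ hx⟩ hx, fun h x hx => h x hx⟩

theorem sat_bex (hS : ∀ x ∈ S, ∀ y ∈ x, y ∈ S) (a : Fin n) (f : SF (n + 1)) : Sat S (.bex a f) w ↔
    ∃ x, ∃ h : x ∈ (w a : ZFSet), Sat S f (vecCons ⟨x, hS _ (w a).2 _ h⟩ w) := by
  simp only [SF.bex, sat_ex, sat_and, sat_mem, Matrix.cons_val_zero, Matrix.cons_val_succ]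
  exact ⟨fun ⟨x, hx, h⟩ => ⟨x, hx, h⟩, fun ⟨x, hx, h⟩ => ⟨⟨x, hS _ (w a).2 _ hx⟩, hx, h⟩⟩

theorem sat_upair (hS : ∀ x ∈ S, ∀ y ∈ x, y ∈ S) (z a b : Fin n) :
    Sat S (.upair z a b) w ↔ (w z : ZFSet) = {(w a : ZFSet), (w b : ZFSet)} := by
  simp only [SF.upair, sat_and, sat_mem, sat_ball w hS, sat_or, sat_eq, Matrix.cons_val_zero,
    Matrix.cons_val_succ]
  constructor
  · rintro ⟨ha, hb, h⟩
    ext x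
    rw [ZFSet.mem_pair]
    exact ⟨h x, by rintro (rfl | rfl) <;> assumption⟩
  · intro h
    rw [h]
    simp

theorem sat_opair (hS : ∀ x ∈ S, ∀ y ∈ x, y ∈ S) (p a b : Fin n) :
    Sat S (.opair p a b) w ↔ (w p : ZFSet) = ZFSet.pair (w a) (w b) := by
  simp only [SF.opair, sat_and, sat_ex, sat_upair _ hS, Matrix.cons_val_zero,
    Matrix.cons_val_succ, Matrix.cons_val_one]
  constructor
  · rintro ⟨x, y, h1, h2, h3⟩
    rw [h3, h1, h2, ZFSet.pair_eq_singleton, ZFSet.pair]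
  · intro h
    have h1 : {(w a : ZFSet)} ∈ (w p : ZFSet) := by rw [h, ZFSet.pair]; simp
    have h2 : {(w a : ZFSet), (w b : ZFSet)} ∈ (w p : ZFSet) := by rw [h, ZFSet.pair]; simp
    refine ⟨⟨_, hS _ (w p).2 _ h2⟩, ⟨_, hS _ (w p).2 _ h1⟩, ?_, rfl, h⟩
    simp [ZFSet.pair_eq_singleton]

theorem pair_mem_imp (hS : ∀ x ∈ S, ∀ y ∈ x, y ∈ S)
    {x y : ZFSet} (h : ZFSet.pair x y ∈ S) : x ∈ S ∧ y ∈ S := by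
  have h2 : ({x, y} : ZFSet) ∈ S := hS _ h _ (by simp [ZFSet.pair])
  exact ⟨hS _ h2 _ (by simp), hS _ h2 _ (by simp)⟩

theorem sat_app (hS : ∀ x ∈ S, ∀ y ∈ x, y ∈ S) (f i x : Fin n) :
    Sat S (.app f i x) w ↔ App (w f) (w i) (w x) := by
  simp only [SF.app, sat_and, sat_ex, sat_opair _ hS, sat_mem, Matrix.cons_val_zero,
    Matrix.cons_val_succ, App]
  exact ⟨fun ⟨p, h, h'⟩ => h ▸ h', fun h => ⟨⟨_, hS _ (w f).2 _ h⟩, rfl, h⟩⟩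

theorem sat_val (hS : ∀ x ∈ S, ∀ y ∈ x, y ∈ S) (g i j k : Fin n) :
    Sat S (.val g i j k) w ↔ Val (w g) (w i) (w j) (w k) := by
  simp only [SF.val, sat_and, sat_ex, sat_opair _ hS, sat_app _ hS, Matrix.cons_val_zero,
    Matrix.cons_val_succ, App, Val]
  exact ⟨fun ⟨p, h, h'⟩ => h ▸ h',
    fun h => ⟨⟨_, (pair_mem_imp hS (hS _ (w g).2 _ h)).1⟩, rfl, h⟩⟩

theorem App.mem (hS : ∀ x ∈ S, ∀ y ∈ x, y ∈ S)
    {f i x : ZFSet} (h : App f i x) (hf : f ∈ S) : x ∈ S :=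
  (pair_mem_imp hS (hS _ hf _ h)).2

theorem Val.mem (hS : ∀ x ∈ S, ∀ y ∈ x, y ∈ S)
    {g i j x : ZFSet} (h : Val g i j x) (hg : g ∈ S) : x ∈ S :=
  (pair_mem_imp hS (hS _ hg _ h)).2

theorem sat_exApp (hS : ∀ x ∈ S, ∀ y ∈ x, y ∈ S) (f i : Fin n) (φ : SF (n + 1)) :
    Sat S (.exApp f i φ) w ↔
    ∃ x, ∃ h : App (w f) (w i) x, Sat S φ (vecCons ⟨x, h.mem hS (w f).2⟩ w) := by
  simp only [SF.exApp, sat_ex, sat_and, sat_app _ hS, Matrix.cons_val_zero, Matrix.cons_val_succ]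
  exact ⟨fun ⟨x, hx, h⟩ => ⟨x, hx, h⟩, fun ⟨x, hx, h⟩ => ⟨⟨x, hx.mem hS (w f).2⟩, hx, h⟩⟩

theorem sat_allApp (hS : ∀ x ∈ S, ∀ y ∈ x, y ∈ S) (f i : Fin n) (φ : SF (n + 1)) :
    Sat S (.allApp f i φ) w ↔
    ∀ x, ∀ h : App (w f) (w i) x, Sat S φ (vecCons ⟨x, h.mem hS (w f).2⟩ w) := by
  simp only [SF.allApp, sat_all, sat_imp, sat_app _ hS, Matrix.cons_val_zero, Matrix.cons_val_succ]
  exact ⟨fun h x hx => h ⟨x, hx.mem hS (w f).2⟩ hx, fun h x hx => h x hx⟩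

theorem sat_exVal (hS : ∀ x ∈ S, ∀ y ∈ x, y ∈ S) (g i j : Fin n) (φ : SF (n + 1)) :
    Sat S (.exVal g i j φ) w ↔
    ∃ x, ∃ h : Val (w g) (w i) (w j) x, Sat S φ (vecCons ⟨x, h.mem hS (w g).2⟩ w) := by
  simp only [SF.exVal, sat_ex, sat_and, sat_val _ hS, Matrix.cons_val_zero, Matrix.cons_val_succ]
  exact ⟨fun ⟨x, hx, h⟩ => ⟨x, hx, h⟩, fun ⟨x, hx, h⟩ => ⟨⟨x, hx.mem hS (w g).2⟩, hx, h⟩⟩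

theorem sat_allVal (hS : ∀ x ∈ S, ∀ y ∈ x, y ∈ S) (g i j : Fin n) (φ : SF (n + 1)) :
    Sat S (.allVal g i j φ) w ↔
    ∀ x, ∀ h : Val (w g) (w i) (w j) x, Sat S φ (vecCons ⟨x, h.mem hS (w g).2⟩ w) := by
  simp only [SF.allVal, sat_all, sat_imp, sat_val _ hS, Matrix.cons_val_zero, Matrix.cons_val_succ]
  exact ⟨fun h x hx => h ⟨x, hx.mem hS (w g).2⟩ hx, fun h x hx => h x hx⟩

theorem sat_ord (hS : ∀ x ∈ S, ∀ y ∈ x, y ∈ S) (x : Fin n) : Sat S (.ord x) w ↔ IsOrd (w x) := by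
  simp only [SF.ord, sat_and, sat_ball _ hS, sat_mem, Matrix.cons_val_zero, Matrix.cons_val_succ,
    Matrix.cons_val]
  rfl

theorem sat_setOfOrds (hS : ∀ x ∈ S, ∀ y ∈ x, y ∈ S) (x : Fin n) :
    Sat S (.setOfOrds x) w ↔ ∀ y ∈ (w x : ZFSet), IsOrd y := by
  simp only [SF.setOfOrds, sat_ball _ hS, sat_ord _ hS, Matrix.cons_val_zero]

theorem sat_pairing (hS : ∀ x ∈ S, ∀ y ∈ x, y ∈ S) (β g : Fin n) :
    Sat S (.pairing β g) w ↔ IsPairing (w β) (w g) := by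
  simp only [SF.pairing, sat_and, sat_imp, sat_ball _ hS, sat_bex _ hS, sat_exVal _ hS,
    sat_allVal _ hS, sat_eq, sat_val _ hS, sat_lexLT, Matrix.cons_val_zero, Matrix.cons_val_one,
    Matrix.cons_val_succ, Matrix.cons_val, exists_prop, and_true, IsPairing]

theorem sat_codeRel (hS : ∀ x ∈ S, ∀ y ∈ x, y ∈ S) (g A i j : Fin n) :
    Sat S (.codeRel g A i j) w ↔ CodeRel (w g) (w A) (w i) (w j) := by
  simp only [SF.codeRel, sat_bex _ hS, sat_val _ hS, Matrix.cons_val_zero, Matrix.cons_val_succ,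
    exists_prop, CodeRel]

theorem sat_decoding (hS : ∀ x ∈ S, ∀ y ∈ x, y ∈ S) (β g A f : Fin n) :
    Sat S (.decoding β g A f) w ↔ IsDecoding (w β) (w g) (w A) (w f) := by
  simp only [SF.decoding, sat_and, sat_imp, sat_ball _ hS, sat_bex _ hS, sat_exApp _ hS,
    sat_allApp _ hS, sat_eq, sat_app _ hS, sat_codeRel _ hS, Matrix.cons_val_zero,
    Matrix.cons_val_one, Matrix.cons_val_succ, Matrix.cons_val, exists_prop, and_true, IsDecoding]

theorem sat_wf (hS : ∀ x ∈ S, ∀ y ∈ x, y ∈ S) (β g A : Fin n) :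
    Sat S (.wf β g A) w ↔ ∀ s ∈ S, s ⊆ (w β : ZFSet) →
    ∀ z ∈ s, ∃ j ∈ s, ∀ i ∈ s, ¬ CodeRel (w g) (w A) i j := by
  simp only [SF.wf, sat_all, sat_not, sat_imp, sat_ball _ hS, sat_bex _ hS, sat_mem,
    sat_codeRel _ hS, Matrix.cons_val_zero, Matrix.cons_val_one, Matrix.cons_val_succ,
    Matrix.cons_val, exists_prop, Subtype.forall]
  rfl

theorem sat_codingAx (hS : ∀ x ∈ S, ∀ y ∈ x, y ∈ S) (w : Fin 0 → S) :
    Sat S .codingAx w ↔ ∀ x ∈ S, ∃ β ∈ S, ∃ g ∈ S, ∃ A ∈ S,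
    ∃ f ∈ S, IsOrd β ∧ IsPairing β g ∧ (∀ y ∈ A, IsOrd y) ∧ IsDecoding β g A f ∧
      ∃ i ∈ β, App f i x := by
  simp only [SF.codingAx, sat_all, sat_ex, sat_and, sat_bex _ hS, sat_ord _ hS, sat_pairing _ hS,
    sat_setOfOrds _ hS, sat_decoding _ hS, sat_app _ hS, Matrix.cons_val, exists_prop,
    Subtype.forall, Subtype.exists]

theorem sat_decodingAx (hS : ∀ x ∈ S, ∀ y ∈ x, y ∈ S) (w : Fin 0 → S) :
    Sat S .decodingAx w ↔ ∀ β ∈ S, ∀ A ∈ S, IsOrd β →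
    ∃ g ∈ S, IsPairing β g ∧
      ((∀ s ∈ S, s ⊆ β → ∀ z ∈ s, ∃ j ∈ s, ∀ i ∈ s, ¬ CodeRel g A i j) →
        ∃ f ∈ S, IsDecoding β g A f) := by
  simp only [SF.decodingAx, sat_all, sat_ex, sat_and, sat_imp, sat_wf _ hS, sat_ord _ hS,
    sat_pairing _ hS, sat_decoding _ hS, Matrix.cons_val, exists_prop,
    Subtype.forall, Subtype.exists]

end Sat

section Collapse

universe a w

/-- The Mostowski collapse of a set-like well-founded relation. -/
noncomputable def collapse {I : Type a} {r : I → I → Prop} (hr : WellFounded r)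
    [∀ i, Small.{w} {j // r j i}] : I → ZFSet.{w} :=
  hr.fix fun i ih => ZFSet.range fun j : {j // r j i} => ih j j.2

theorem mem_collapse {I : Type a} {r : I → I → Prop} (hr : WellFounded r)
    [∀ i, Small.{w} {j // r j i}] {i : I} {y : ZFSet.{w}} :
    y ∈ collapse hr i ↔ ∃ j, r j i ∧ collapse hr j = y := by
  rw [collapse, hr.fix_eq, ZFSet.mem_range, Subtype.exists]
  simp only [exists_prop]

end Collapse

theorem IsOrd.isOrdinal {x : ZFSet} (h : IsOrd x) : x.IsOrdinal :=
  ZFSet.isOrdinal_iff_forall_mem_isTransitive.2 h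

theorem IsOrd.mem {x y : ZFSet} (h : IsOrd x) (hy : y ∈ x) : IsOrd y :=
  ⟨h.2 y hy, fun z hz => h.2 z (h.1 y hy hz)⟩

theorem IsPairing.unique {β g g' : ZFSet} (hg : IsPairing β g) (hg' : IsPairing β g')
    {i : ZFSet} (hi : i ∈ β) {j : ZFSet} (hj : j ∈ β) {k k' : ZFSet}
    (hk : Val g i j k) (hk' : Val g' i j k') : k = k' := by
  induction i using ZFSet.inductionOn generalizing j k k' with | _ i ihi
  induction j using ZFSet.inductionOn generalizing k k' with | _ j ihj
  have key {i' j' y y'} (hi' : i' ∈ β) (hj' : j' ∈ β) (hl : LexLT i' j' i j)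
      (hy : Val g i' j' y) (hy' : Val g' i' j' y') : y = y' := by
    obtain hl | ⟨rfl, hl⟩ := hl
    · exact ihi i' hl hi' hj' hy hy'
    · exact ihj j' hl hj' hy hy'
  obtain ⟨h1, h2⟩ := (hg i hi j hj).2 k hk
  obtain ⟨h1', h2'⟩ := (hg' i hi j hj).2 k' hk'
  ext y
  constructor
  · intro hy
    obtain ⟨i', hi', j', hj', hl, hv⟩ := h1 y hy
    obtain ⟨y', hy', hv'⟩ := h2' i' hi' j' hj' hl
    rwa [key hi' hj' hl hv hv']
  · intro hy
    obtain ⟨i', hi', j', hj', hl, hv⟩ := h1' y hy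
    obtain ⟨y', hy', hv'⟩ := h2 i' hi' j' hj' hl
    rwa [← key hi' hj' hl hv' hv]

/-- The codes and their decodings are the same in any two transitive classes with the same sets
of ordinals. -/
theorem subset_of_codingAx {N N' : Set ZFSet} (hN : ∀ x ∈ N, ∀ y ∈ x, y ∈ N)
    (hN' : ∀ x ∈ N', ∀ y ∈ x, y ∈ N') (h : Sat N .codingAx ![]) (h' : Sat N' .decodingAx ![])
    (hord : ∀ A ∈ N, (∀ y ∈ A, IsOrd y) → A ∈ N') : N ⊆ N' := by
  rw [sat_codingAx hN] at h
  rw [sat_decodingAx hN'] at h'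
  intro x hx
  obtain ⟨β, hβN, g, -, A, hAN, f, -, hβ, hg, hA, hf, i₀, hi₀, hfx⟩ := h x hx
  have hβN' := hord β hβN fun y => hβ.mem
  obtain ⟨g', hg'N, hg', hdec⟩ := h' β hβN' A (hord A hAN hA) hβ
  have hrel {i j} (hi : i ∈ β) (hj : j ∈ β) : CodeRel g' A i j ↔ CodeRel g A i j := by
    constructor
    · rintro ⟨k, hk, hv⟩
      obtain ⟨k', hk'⟩ := (hg i hi j hj).1
      exact ⟨k', hg.unique hg' hi hj hk' hv ▸ hk, hk'⟩
    · rintro ⟨k, hk, hv⟩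
      obtain ⟨k', hk'⟩ := (hg' i hi j hj).1
      exact ⟨k', hg'.unique hg hi hj hk' hv ▸ hk, hk'⟩
  have huniq {x : ZFSet} : ∀ {j x'}, j ∈ β → App f j x → App f j x' → x = x' := by
    induction x using ZFSet.inductionOn with | _ x ih
    intro j x' hj hx hx'
    obtain ⟨h1, h2⟩ := (hf j hj).2 x hx
    obtain ⟨h1', h2'⟩ := (hf j hj).2 x' hx'
    ext y
    constructor
    · intro hy
      obtain ⟨i, hi, hr, ha⟩ := h1 y hy
      obtain ⟨y', hy', ha'⟩ := h2' i hi hr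
      rwa [ih y hy hi ha ha']
    · intro hy
      obtain ⟨i, hi, hr, ha⟩ := h1' y hy
      obtain ⟨y', hy', ha'⟩ := h2 i hi hr
      rwa [← ih y' hy' hi ha' ha]
  choose F hF using fun j : β => (hf j j.2).1
  have hlt {i j : β} (hr : CodeRel g A i j) : F i ∈ F j := by
    obtain ⟨y, hy, ha⟩ := ((hf j j.2).2 _ (hF j)).2 i i.2 hr
    rwa [huniq i.2 (hF i) ha]
  obtain ⟨f', hf'N, hf'⟩ := hdec fun s _ hs z hz => by
    obtain ⟨⟨j, hj⟩, hjs, hmin⟩ := (InvImage.wf F ZFSet.mem_wf).has_min {j : β | (j : ZFSet) ∈ s}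
      ⟨⟨z, hs hz⟩, hz⟩
    exact ⟨j, hjs, fun i hi hr => hmin ⟨i, hs hi⟩ hi
      (hlt (i := ⟨i, hs hi⟩) (j := ⟨j, hj⟩) ((hrel (hs hi) hj).1 hr))⟩
  have hagree {x : ZFSet} : ∀ {j x'}, j ∈ β → App f j x → App f' j x' → x = x' := by
    induction x using ZFSet.inductionOn with | _ x ih
    intro j x' hj hx hx'
    obtain ⟨h1, h2⟩ := (hf j hj).2 x hx
    obtain ⟨h1', h2'⟩ := (hf' j hj).2 x' hx'
    ext y
    constructor
    · intro hy
      obtain ⟨i, hi, hr, ha⟩ := h1 y hy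
      obtain ⟨y', hy', ha'⟩ := h2' i hi ((hrel hi hj).2 hr)
      rwa [ih y hy hi ha ha']
    · intro hy
      obtain ⟨i, hi, hr, ha⟩ := h1' y hy
      obtain ⟨y', hy', ha'⟩ := h2 i hi ((hrel hi hj).1 hr)
      rwa [← ih y' hy' hi ha' ha]
  obtain ⟨x', hx'⟩ := (hf' i₀ hi₀).1
  rw [hagree hi₀ hfx hx']
  exact hx'.mem hN' hf'N

section Graphs

/-- The graph of a function on a set. -/
noncomputable def graph {β : ZFSet} (F : β → ZFSet) : ZFSet :=
  ZFSet.range fun i : β => ZFSet.pair i (F i)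

theorem app_graph {β : ZFSet} {F : β → ZFSet} {i : β} {x : ZFSet} :
    App (graph F) i x ↔ x = F i := by
  simp only [App, graph, ZFSet.mem_range, ZFSet.pair_inj]
  constructor
  · rintro ⟨j, hj, rfl⟩
    rw [Subtype.ext hj]
  · rintro rfl
    exact ⟨i, rfl, rfl⟩

/-- The graph of a function of two variables on a set. -/
noncomputable def graph₂ {β : ZFSet} (k : β → β → ZFSet) : ZFSet :=
  ZFSet.range fun p : β × β => ZFSet.pair (ZFSet.pair p.1 p.2) (k p.1 p.2)

theorem val_graph₂ {β : ZFSet} {k : β → β → ZFSet} {i j : β} {x : ZFSet} :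
    Val (graph₂ k) i j x ↔ x = k i j := by
  simp only [Val, graph₂, ZFSet.mem_range, ZFSet.pair_inj]
  constructor
  · rintro ⟨p, ⟨h1, h2⟩, rfl⟩
    rw [Subtype.ext h1, Subtype.ext h2]
  · rintro rfl
    exact ⟨(i, j), ⟨rfl, rfl⟩, rfl⟩

theorem codeRel_graph₂ {β A : ZFSet} {k : β → β → ZFSet} {i j : β} :
    CodeRel (graph₂ k) A i j ↔ k i j ∈ A := by
  simp [CodeRel, val_graph₂]

theorem isDecoding_graph {β g A : ZFSet} {F : β → ZFSet}
    (hF : ∀ j y, y ∈ F j ↔ ∃ i : β, CodeRel g A i j ∧ F i = y) :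
    IsDecoding β g A (graph F) := by
  intro j hj
  lift j to β using hj
  refine ⟨⟨_, app_graph.2 rfl⟩, fun x hx => ?_⟩
  obtain rfl := app_graph.1 hx
  constructor
  · intro y hy
    obtain ⟨i, hr, rfl⟩ := (hF j y).1 hy
    exact ⟨i, i.2, hr, app_graph.2 rfl⟩
  · intro i hi hr
    exact ⟨F ⟨i, hi⟩, (hF _ _).2 ⟨⟨i, hi⟩, hr, rfl⟩, app_graph (i := ⟨i, hi⟩).2 rfl⟩

/-- The Mostowski collapse of the lexicographic order on `β × β`. -/
theorem exists_lex_collapse.{u} {β : ZFSet.{u}} (hβ : IsOrd β) : ∃ k : β → β → ZFSet.{u},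
    (∀ i j y, y ∈ k i j ↔ ∃ i' j' : β, LexLT i' j' i j ∧ k i' j' = y) ∧
    (∀ i j, IsOrd (k i j)) ∧ ∀ i j i' j', k i j = k i' j' → i = i' ∧ j = j' := by
  let r : β × β → β × β → Prop := fun p q => LexLT p.1 p.2 q.1 q.2
  have hwf : WellFounded fun i j : β => (i : ZFSet) ∈ (j : ZFSet) := InvImage.wf _ ZFSet.mem_wf
  have hr : WellFounded r := by
    refine Subrelation.wf (fun {p q} h => ?_) (WellFounded.prod_lex hwf hwf)
    rw [Prod.lex_def]
    exact h.imp id fun h => ⟨Subtype.ext h.1, h.2⟩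
  have hmem (i j : β) (y : ZFSet.{u}) :
      y ∈ collapse hr (i, j) ↔ ∃ i' j' : β, LexLT i' j' i j ∧ collapse hr (i', j') = y := by
    rw [mem_collapse, Prod.exists]
  have htr (i j : β) : (collapse.{u + 1, u} hr (i, j)).IsTransitive := by
    intro y hy z hz
    obtain ⟨i', j', hl, rfl⟩ := (hmem i j y).1 hy
    obtain ⟨i'', j'', hl', rfl⟩ := (hmem i' j' z).1 hz
    refine (hmem i j _).2 ⟨i'', j'', ?_, rfl⟩
    obtain hl | ⟨h, hl⟩ := hl <;> obtain hl' | ⟨h', hl'⟩ := hl'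
    · exact Or.inl (hβ.2 i i.2 _ hl hl')
    · exact Or.inl (h' ▸ hl)
    · exact Or.inl (h ▸ hl')
    · exact Or.inr ⟨h'.trans h, hβ.2 j j.2 _ hl hl'⟩
  refine ⟨fun i j => collapse hr (i, j), hmem, fun i j => ⟨htr i j, fun y hy => ?_⟩, ?_⟩
  · obtain ⟨i', j', -, rfl⟩ := (hmem i j y).1 hy
    exact htr i' j'
  · intro i j i' j' h
    have hlt {i j i' j' : β} (hl : LexLT i j i' j') :
        collapse.{u + 1, u} hr (i, j) ≠ collapse hr (i', j') := by
      intro h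
      have := (hmem i' j' _).2 ⟨i, j, hl, rfl⟩
      rw [h] at this
      exact ZFSet.mem_irrefl _ this
    have hO (i : β) := (hβ.mem i.2).isOrdinal
    obtain hi | hi | hi := (hO i).mem_trichotomous (hO i')
    · exact (hlt (Or.inl hi) h).elim
    · obtain hj | hj | hj := (hO j).mem_trichotomous (hO j')
      · exact (hlt (Or.inr ⟨hi, hj⟩) h).elim
      · exact ⟨Subtype.ext hi, Subtype.ext hj⟩
      · exact (hlt (Or.inr ⟨hi.symm, hj⟩) h.symm).elim
    · exact (hlt (Or.inl hi) h.symm).elim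

theorem isPairing_graph₂ {β : ZFSet} {k : β → β → ZFSet}
    (hk : ∀ i j y, y ∈ k i j ↔ ∃ i' j' : β, LexLT i' j' i j ∧ k i' j' = y) :
    IsPairing β (graph₂ k) := by
  intro i hi j hj
  lift i to β using hi
  lift j to β using hj
  refine ⟨⟨_, val_graph₂.2 rfl⟩, fun x hx => ?_⟩
  obtain rfl := val_graph₂.1 hx
  constructor
  · intro y hy
    obtain ⟨i', j', hl, rfl⟩ := (hk i j y).1 hy
    exact ⟨i', i'.2, j', j'.2, hl, val_graph₂.2 rfl⟩
  · intro i' hi' j' hj' hl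
    exact ⟨k ⟨i', hi'⟩ ⟨j', hj'⟩, (hk _ _ _).2 ⟨⟨i', hi'⟩, ⟨j', hj'⟩, hl, rfl⟩,
      val_graph₂ (i := ⟨i', hi'⟩) (j := ⟨j', hj'⟩).2 rfl⟩

end Graphs

section HSet

theorem HSet.mem_trans {θ x y : ZFSet} (hx : x ∈ HSet θ) (hy : y ∈ x) : y ∈ HSet θ :=
  have h : tcl y ⊆ tcl x := fun _ hz => Relation.TransGen.tail hz hy
  (Cardinal.mk_le_mk_of_subset h).trans_lt hx

theorem mem_HSet_of_subset {θ x : ZFSet} {T : Set ZFSet} (hT : ∀ x ∈ T, ∀ y ∈ x, y ∈ T)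
    (hc : #T < card θ) (hx : ∀ y ∈ x, y ∈ T) : x ∈ HSet θ := by
  refine (Cardinal.mk_le_mk_of_subset fun y (hy : Relation.TransGen _ y x) => ?_).trans_lt hc
  induction hy using Relation.TransGen.head_induction_on with
  | single h => exact hx _ h
  | head h _ ih => exact hT _ ih _ h

/-- `T` together with all unordered pairs of elements of `T`. -/
def addPairs (T : Set ZFSet) : Set ZFSet :=
  T ∪ Set.range fun p : T × T => {(p.1 : ZFSet), (p.2 : ZFSet)}

theorem addPairs_trans {T : Set ZFSet} (hT : ∀ x ∈ T, ∀ y ∈ x, y ∈ T) :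
    ∀ x ∈ addPairs T, ∀ y ∈ x, y ∈ addPairs T := by
  rintro x (hx | ⟨p, rfl⟩) y hy
  · exact Or.inl (hT x hx y hy)
  · obtain rfl | rfl := ZFSet.mem_pair.1 hy
    exacts [Or.inl p.1.2, Or.inl p.2.2]

theorem mk_addPairs_lt {T : Set ZFSet} {κ : Cardinal} (hκ : ℵ₀ ≤ κ) (hT : #T < κ) :
    #(addPairs T) < κ :=
  (Cardinal.mk_union_le _ _).trans_lt <| Cardinal.add_lt_of_lt hκ hT <|
    Cardinal.mk_range_le.trans_lt <| by
      rw [Cardinal.mk_prod, Cardinal.lift_id]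
      exact Cardinal.mul_lt_of_lt hκ hT hT

theorem upair_mem_addPairs {T : Set ZFSet} {a b : ZFSet} (ha : a ∈ T) (hb : b ∈ T) :
    ({a, b} : ZFSet) ∈ addPairs T :=
  Or.inr ⟨(⟨a, ha⟩, ⟨b, hb⟩), rfl⟩

theorem pair_mem_addPairs {T : Set ZFSet} {a b : ZFSet} (ha : a ∈ T) (hb : b ∈ T) :
    ZFSet.pair a b ∈ addPairs (addPairs T) := by
  refine upair_mem_addPairs ?_ (upair_mem_addPairs ha hb)
  rw [← ZFSet.pair_eq_singleton]
  exact upair_mem_addPairs ha ha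

theorem aleph0_le_card_omega.{u} : ℵ₀ ≤ card ZFSet.omega.{u} := by
  refine Cardinal.aleph0_le_mk_iff.2 ?_
  let f : ℕ → ZFSet.omega.{u}.toSet := Nat.rec ⟨∅, ZFSet.omega_zero⟩
    fun _ x => ⟨insert x.1 x.1, ZFSet.omega_succ x.2⟩
  have hf : StrictMono fun n => (f n).1.rank :=
    strictMono_nat_of_lt_succ fun n => ZFSet.rank_lt_of_mem (ZFSet.mem_insert (f n).1 (f n).1)
  exact Infinite.of_injective f fun m n h => hf.injective (by simp only [h])

theorem IsRegCard.aleph0_le {θ : ZFSet} (hθ : IsRegCard θ) : ℵ₀ ≤ card θ :=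
  aleph0_le_card_omega.trans (Cardinal.mk_le_mk_of_subset fun _ hx => hθ.2.1 hx)

theorem mk_lt_of_mem_HSet {θ x : ZFSet} (hx : x ∈ HSet θ) : #x < card θ :=
  (Cardinal.mk_le_mk_of_subset fun _ hy => Relation.TransGen.single hy).trans_lt hx

theorem mem_of_mem_HSet {θ α : ZFSet} (hθ : IsRegCard θ) (hα : IsOrd α) (h : α ∈ HSet θ) :
    α ∈ θ := by
  by_contra hn
  have hs := (hα.isOrdinal.notMem_iff_subset hθ.1.1.isOrdinal).1 hn
  exact (mk_lt_of_mem_HSet h).not_ge (Cardinal.mk_le_mk_of_subset fun _ hx => hs hx)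

theorem IsOrd.mem_HSet {θ α : ZFSet} (hθ : IsRegCard θ) (h : α ∈ θ) : α ∈ HSet θ :=
  mem_HSet_of_subset (T := α.toSet) ((hθ.1.1.mem h).1) (hθ.1.2 α h) fun _ => id

theorem exists_mem_card_le {θ : ZFSet} (hθ : IsRegCard θ) {c : Cardinal} (hc : c < card θ) :
    ∃ β ∈ θ, c ≤ card β := by
  have := hθ.1.1.isOrdinal.isWellOrder
  let r := Subrel (· ∈ ·) (· ∈ θ)
  have hlt : c.ord < Ordinal.type r := by
    rw [← not_le]
    intro h
    have := Ordinal.card_le_card h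
    rw [Cardinal.card_ord, Ordinal.card_type] at this
    exact this.not_gt hc
  obtain ⟨⟨β, hβ⟩, h⟩ := Ordinal.typein_surj r hlt
  refine ⟨β, hβ, ?_⟩
  rw [← Cardinal.card_ord c, ← h, Ordinal.card_typein]
  exact Cardinal.mk_le_of_injective (f := fun y => (⟨y.1.1, y.2⟩ : β.toSet))
    fun x y h => Subtype.ext (Subtype.ext (congrArg (fun z : β.toSet => (z : ZFSet)) h))

theorem graph_mem_HSet {θ β : ZFSet} (hθ : ℵ₀ ≤ card θ) (hβ : IsOrd β) (hβθ : β ∈ HSet θ)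
    {F : β → ZFSet} (hF : ∀ j, ∀ y ∈ F j, ∃ i, F i = y) : graph F ∈ HSet θ := by
  let T : Set ZFSet := β.toSet ∪ Set.range F
  have hT : ∀ x ∈ T, ∀ y ∈ x, y ∈ T := by
    rintro x (hx | ⟨i, rfl⟩) y hy
    · exact Or.inl (hβ.1 x hx hy)
    · exact Or.inr (hF i y hy)
  have hc : #T < card θ := (Cardinal.mk_union_le _ _).trans_lt <|
    Cardinal.add_lt_of_lt hθ (mk_lt_of_mem_HSet hβθ)
      (Cardinal.mk_range_le.trans_lt (mk_lt_of_mem_HSet hβθ))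
  refine mem_HSet_of_subset (addPairs_trans (addPairs_trans hT))
    (mk_addPairs_lt hθ (mk_addPairs_lt hθ hc)) fun y hy => ?_
  obtain ⟨i, rfl⟩ := ZFSet.mem_range.1 hy
  exact pair_mem_addPairs (Or.inl i.2) (Or.inr ⟨i, rfl⟩)

theorem mem_HSet_of_subset_range₂ {θ β A : ZFSet} (hθ : ℵ₀ ≤ card θ) (hβθ : β ∈ HSet θ)
    {k : β → β → ZFSet} (hk : ∀ i j, ∀ y ∈ k i j, ∃ i' j', k i' j' = y)
    (hA : ∀ y ∈ A, ∃ i j, k i j = y) : A ∈ HSet θ := by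
  refine mem_HSet_of_subset (T := Set.range fun p : β × β => k p.1 p.2) ?_ ?_ fun y hy => ?_
  · rintro _ ⟨p, rfl⟩ y hy
    obtain ⟨i', j', h⟩ := hk _ _ y hy
    exact ⟨(i', j'), h⟩
  · refine Cardinal.mk_range_le.trans_lt ?_
    rw [Cardinal.mk_prod, Cardinal.lift_id]
    exact Cardinal.mul_lt_of_lt hθ (mk_lt_of_mem_HSet hβθ) (mk_lt_of_mem_HSet hβθ)
  · obtain ⟨i, j, h⟩ := hA y hy
    exact ⟨(i, j), h⟩

theorem graph₂_mem_HSet {θ β : ZFSet} (hθ : ℵ₀ ≤ card θ) (hβ : IsOrd β) (hβθ : β ∈ HSet θ)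
    {k : β → β → ZFSet} (hk : ∀ i j, ∀ y ∈ k i j, ∃ i' j', k i' j' = y) :
    graph₂ k ∈ HSet θ := by
  let T : Set ZFSet := β.toSet ∪ Set.range fun p : β × β => k p.1 p.2
  have hT : ∀ x ∈ T, ∀ y ∈ x, y ∈ T := by
    rintro x (hx | ⟨p, rfl⟩) y hy
    · exact Or.inl (hβ.1 x hx hy)
    · obtain ⟨i', j', h⟩ := hk _ _ y hy
      exact Or.inr ⟨(i', j'), h⟩
  have hc : #T < card θ := by
    refine (Cardinal.mk_union_le _ _).trans_lt <|
      Cardinal.add_lt_of_lt hθ (mk_lt_of_mem_HSet hβθ) (Cardinal.mk_range_le.trans_lt ?_)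
    rw [Cardinal.mk_prod, Cardinal.lift_id]
    exact Cardinal.mul_lt_of_lt hθ (mk_lt_of_mem_HSet hβθ) (mk_lt_of_mem_HSet hβθ)
  have htr := addPairs_trans (addPairs_trans hT)
  have hlt := mk_addPairs_lt hθ (mk_addPairs_lt hθ hc)
  refine mem_HSet_of_subset (addPairs_trans (addPairs_trans htr))
    (mk_addPairs_lt hθ (mk_addPairs_lt hθ hlt)) fun y hy => ?_
  obtain ⟨p, rfl⟩ := ZFSet.mem_range.1 hy
  exact pair_mem_addPairs (pair_mem_addPairs (Or.inl p.1.2) (Or.inl p.2.2))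
    (Or.inl (Or.inl (Or.inr ⟨p, rfl⟩)))

theorem sat_codingAx_HSet {θ : ZFSet} (hθ : IsRegCard θ) : Sat (HSet θ) .codingAx ![] := by
  rw [sat_codingAx fun x hx y => HSet.mem_trans hx]
  intro x hx
  let T : Set ZFSet := insert x (tcl x)
  have hT : ∀ y ∈ T, ∀ z ∈ y, z ∈ T := by
    rintro y (rfl | hy) z hz
    · exact Or.inr (Relation.TransGen.single hz)
    · exact Or.inr (Relation.TransGen.head hz hy)
  have hc : #T < card θ := Cardinal.mk_insert_le.trans_lt <|
    Cardinal.add_lt_of_lt hθ.aleph0_le hx (Cardinal.one_lt_aleph0.trans_le hθ.aleph0_le)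
  obtain ⟨β, hβθ, hβT⟩ := exists_mem_card_le hθ hc
  have hβ := hθ.1.1.mem hβθ
  have hβH := IsOrd.mem_HSet hθ hβθ
  obtain ⟨e⟩ : Nonempty (T ↪ β) := hβT
  have : Nonempty T := ⟨⟨x, Or.inl rfl⟩⟩
  let F : β → ZFSet := fun i => (Function.invFun e i : T)
  have hF (y : ZFSet) (hy : y ∈ T) : ∃ i, F i = y :=
    ⟨e ⟨y, hy⟩, congrArg Subtype.val (Function.leftInverse_invFun e.injective ⟨y, hy⟩)⟩
  have hFT (i : β) : F i ∈ T := (Function.invFun e i).2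
  obtain ⟨k, hk, hkO, hkinj⟩ := exists_lex_collapse hβ
  have hk' (i j : β) (y : ZFSet) (hy : y ∈ k i j) : ∃ i' j', k i' j' = y :=
    let ⟨i', j', _, h⟩ := (hk i j y).1 hy
    ⟨i', j', h⟩
  let A : ZFSet := ZFSet.range fun p : {p : β × β // F p.1 ∈ F p.2} => k p.1.1 p.1.2
  have hA (i j : β) : k i j ∈ A ↔ F i ∈ F j := by
    rw [ZFSet.mem_range]
    constructor
    · rintro ⟨⟨p, hp⟩, h⟩
      obtain ⟨h1, h2⟩ := hkinj _ _ _ _ h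
      rwa [← h1, ← h2]
    · exact fun h => ⟨⟨(i, j), h⟩, rfl⟩
  obtain ⟨i₀, hi₀⟩ := hF x (Or.inl rfl)
  refine ⟨β, hβH, graph₂ k, graph₂_mem_HSet hθ.aleph0_le hβ hβH hk', A,
    mem_HSet_of_subset_range₂ hθ.aleph0_le hβH hk' fun y hy => ?_, graph F,
    graph_mem_HSet hθ.aleph0_le hβ hβH fun j y hy => hF y (hT _ (hFT j) y hy), hβ,
    isPairing_graph₂ hk, fun y hy => ?_, isDecoding_graph fun j y => ?_, i₀, i₀.2,
    app_graph.2 hi₀.symm⟩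
  · obtain ⟨p, rfl⟩ := ZFSet.mem_range.1 hy
    exact ⟨_, _, rfl⟩
  · obtain ⟨p, rfl⟩ := ZFSet.mem_range.1 hy
    exact hkO _ _
  · simp only [codeRel_graph₂, hA]
    constructor
    · intro hy
      obtain ⟨i, rfl⟩ := hF y (hT _ (hFT j) y hy)
      exact ⟨i, hy, rfl⟩
    · rintro ⟨i, hi, rfl⟩
      exact hi

theorem sat_decodingAx_HSet {θ : ZFSet} (hθ : IsRegCard θ) : Sat (HSet θ) .decodingAx ![] := by
  rw [sat_decodingAx fun x hx y => HSet.mem_trans hx]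
  intro β hβH A _ hβ
  obtain ⟨k, hk, -, -⟩ := exists_lex_collapse hβ
  refine ⟨graph₂ k, graph₂_mem_HSet hθ.aleph0_le hβ hβH fun i j y hy => ?_, isPairing_graph₂ hk,
    fun hwf => ?_⟩
  · obtain ⟨i', j', -, h⟩ := (hk i j y).1 hy
    exact ⟨i', j', h⟩
  have hr : WellFounded fun i j : β => CodeRel (graph₂ k) A i j := by
    rw [WellFounded.wellFounded_iff_has_min]
    rintro s ⟨z, hz⟩
    have hsβ : β.sep (fun y => ∃ h : y ∈ β, ⟨y, h⟩ ∈ s) ⊆ β := fun y hy => (ZFSet.mem_sep.1 hy).1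
    obtain ⟨j, hj, hmin⟩ := hwf (β.sep fun y => ∃ h : y ∈ β, ⟨y, h⟩ ∈ s)
      (mem_HSet_of_subset (T := β.toSet) hβ.1 (mk_lt_of_mem_HSet hβH) hsβ) hsβ z
      (ZFSet.mem_sep.2 ⟨z.2, z.2, hz⟩)
    obtain ⟨-, hjβ, hjs⟩ := ZFSet.mem_sep.1 hj
    exact ⟨⟨j, hjβ⟩, hjs, fun i hi => hmin i (ZFSet.mem_sep.2 ⟨i.2, i.2, hi⟩)⟩
  refine ⟨graph (collapse hr), graph_mem_HSet hθ.aleph0_le hβ hβH fun j y hy => ?_,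
    isDecoding_graph fun j y => mem_collapse hr⟩
  obtain ⟨i, -, h⟩ := (mem_collapse hr).1 hy
  exact ⟨i, h⟩

end HSet

section Models

universe u w

/-- The Mostowski collapse of a class, into a possibly larger universe. -/
noncomputable def classCollapse (M : Set ZFSet.{u}) : M → ZFSet.{max u w} :=
  have (x : M) :
      Small.{max u w} {y : M // InvImage (· ∈ ·) (Subtype.val : M → ZFSet) y x} :=
    have : Small.{u} {y : M // InvImage (· ∈ ·) (Subtype.val : M → ZFSet) y x} :=
      small_of_injective (β := (x : ZFSet)) (f := fun y => ⟨y.1, y.2⟩) fun _ _ h =>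
        Subtype.ext (Subtype.ext (congrArg (fun z : (x : ZFSet) => (z : ZFSet)) h))
    small_lift.{u + 1, w, u} _
  collapse (InvImage.wf (Subtype.val : M → ZFSet) ZFSet.mem_wf)

theorem mem_classCollapse {M : Set ZFSet.{u}} {x : M} {y : ZFSet.{max u w}} :
    y ∈ classCollapse.{u, w} M x ↔
      ∃ z : M, (z : ZFSet) ∈ (x : ZFSet) ∧ classCollapse.{u, w} M z = y := by
  rw [classCollapse, mem_collapse]
  rfl

theorem classCollapse_injective {M : Set ZFSet.{u}} (hM : Sat M .extAx ![]) :
    Function.Injective (classCollapse.{u, w} M) := by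
  rw [sat_extAx] at hM
  suffices ∀ x : ZFSet, ∀ hx : x ∈ M, ∀ y : M,
      classCollapse.{u, w} M ⟨x, hx⟩ = classCollapse.{u, w} M y → ⟨x, hx⟩ = y from
    fun x y => this x x.2 y
  intro x
  induction x using ZFSet.inductionOn with | _ x ih
  intro hx y h
  refine hM _ _ fun z => ⟨fun hz => ?_, fun hz => ?_⟩
  · have := (mem_classCollapse (x := ⟨x, hx⟩)).2 ⟨z, hz, rfl⟩
    rw [h, mem_classCollapse] at this
    obtain ⟨z', hz', h'⟩ := this
    rwa [show z = z' from ih z hz z.2 z' h'.symm]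
  · have := mem_classCollapse.2 ⟨z, hz, rfl⟩
    rw [← h, mem_classCollapse] at this
    obtain ⟨z', hz', h'⟩ := this
    rwa [← ih z' hz' z'.2 z h']

theorem classCollapse_mem_iff {M : Set ZFSet.{u}} (hM : Sat M .extAx ![]) {x y : M} :
    classCollapse.{u, w} M x ∈ classCollapse.{u, w} M y ↔ (x : ZFSet) ∈ (y : ZFSet) := by
  rw [mem_classCollapse]
  constructor
  · rintro ⟨z, hz, h⟩
    rwa [← classCollapse_injective hM h]
  · exact fun h => ⟨x, h, rfl⟩

theorem range_classCollapse_trans {M : Set ZFSet.{u}} :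
    ∀ x ∈ Set.range (classCollapse.{u, w} M), ∀ y ∈ x, y ∈ Set.range (classCollapse.{u, w} M) := by
  rintro _ ⟨x, rfl⟩ y hy
  obtain ⟨z, -, h⟩ := mem_classCollapse.1 hy
  exact ⟨z, h⟩

theorem sat_range_classCollapse {M : Set ZFSet.{u}} (hM : Sat M .extAx ![]) {n : ℕ} (φ : SF n)
    (v : Fin n → M) : Sat (Set.range (classCollapse.{u, w} M)) φ
      (fun i => ⟨classCollapse.{u, w} M (v i), Set.mem_range_self _⟩) ↔ Sat M φ v := by
  induction φ with
  | mem i j => exact classCollapse_mem_iff hM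
  | eq i j => exact (classCollapse_injective hM).eq_iff.trans SetCoe.ext_iff.symm
  | imp f g hf hg => rw [sat_imp, sat_imp, hf, hg]
  | not f hf => rw [sat_not, sat_not, hf]
  | ex f hf =>
    have key (x : M) : vecCons
        (⟨classCollapse.{u, w} M x, Set.mem_range_self _⟩ : Set.range (classCollapse.{u, w} M))
        (fun i => ⟨classCollapse.{u, w} M (v i), Set.mem_range_self _⟩) =
        fun i => ⟨classCollapse.{u, w} M (vecCons x v i), Set.mem_range_self _⟩ := by
      funext i
      cases i using Fin.cases <;> rfl
    rw [sat_ex, sat_ex]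
    constructor
    · rintro ⟨⟨_, x, rfl⟩, h⟩
      rw [key, hf] at h
      exact ⟨x, h⟩
    · rintro ⟨x, h⟩
      refine ⟨⟨_, x, rfl⟩, ?_⟩
      rwa [key, hf]

theorem Prec.sat_iff {M R : Set ZFSet} (h : Prec M R) {n : ℕ} (φ : SF n) (v : Fin n → M) :
    Sat M φ v ↔ Sat R φ fun i => ⟨v i, h.1 (v i).2⟩ :=
  h.2 φ _ fun i => (v i).2

theorem Prec.sat_sentence_iff {M R : Set ZFSet} (h : Prec M R) (φ : SF 0) :
    Sat M φ ![] ↔ Sat R φ ![] := by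
  rw [h.sat_iff]
  exact iff_of_eq (congrArg _ (Subsingleton.elim _ _))

theorem sat_extAx_of_trans {S : Set ZFSet} (hS : ∀ x ∈ S, ∀ y ∈ x, y ∈ S) :
    Sat S .extAx ![] := by
  rw [sat_extAx]
  exact fun x y h => Subtype.ext <| ZFSet.ext fun z =>
    ⟨fun hz => (h ⟨z, hS _ x.2 z hz⟩).1 hz, fun hz => (h ⟨z, hS _ y.2 z hz⟩).2 hz⟩

theorem Prec.sat_extAx {θ : ZFSet} {M : Set ZFSet} (h : Prec M (HSet θ)) : Sat M .extAx ![] :=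
  (h.sat_sentence_iff _).2 (sat_extAx_of_trans fun _ hx _ => HSet.mem_trans hx)

theorem Prec.sat_range_classCollapse_sentence {θ : ZFSet.{u}} {M : Set ZFSet.{u}}
    (h : Prec M (HSet θ)) {φ : SF 0} (hφ : Sat (HSet θ) φ ![]) :
    Sat (Set.range (classCollapse.{u, w} M)) φ ![] := by
  have := (sat_range_classCollapse.{u, w} h.sat_extAx φ ![]).2 ((h.sat_sentence_iff φ).2 hφ)
  convert this using 1

theorem Prec.subset_of_setOfOrds {θ : ZFSet.{u}} (hθ : IsRegCard θ) {M : Set ZFSet.{u}}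
    (h : Prec M (HSet θ)) {x : M} (hx : ∀ y ∈ classCollapse.{u, w} M x, IsOrd y) :
    (x : ZFSet) ⊆ θ := by
  have hH : ∀ x ∈ HSet θ, ∀ y ∈ x, y ∈ HSet θ := fun _ hx _ => HSet.mem_trans hx
  have h1 := (sat_range_classCollapse.{u, w} h.sat_extAx (.setOfOrds 0) ![x]).1
    ((sat_setOfOrds _ range_classCollapse_trans _).2 hx)
  rw [h.sat_iff, sat_setOfOrds _ hH] at h1
  exact fun y hy => mem_of_mem_HSet hθ (h1 y hy) (hH _ (h.1 x.2) y hy)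

end Models

/-- Lemma 5.3: if `⟨M₀ ∩ θ₀, P(θ₀) ∩ M₀, ∈⟩` and `⟨M₁ ∩ θ₁, P(θ₁) ∩ M₁, ∈⟩` are
isomorphic, then `⟨M₀, ∈⟩` and `⟨M₁, ∈⟩` are isomorphic. -/
theorem iso_extends (θ0 θ1 : ZFSet) (h0 : IsRegCard θ0) (h1 : IsRegCard θ1)
    (M0 M1 : Set ZFSet) (hM0 : Prec M0 (HSet θ0)) (hM1 : Prec M1 (HSet θ1))
    (π : ZFSet → ZFSet)
    (hbij : Set.BijOn π ({x | x ∈ M0 ∧ x ∈ θ0} ∪ {x | x ∈ M0 ∧ x ⊆ θ0})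
      ({x | x ∈ M1 ∧ x ∈ θ1} ∪ {x | x ∈ M1 ∧ x ⊆ θ1}))
    (hord : π '' {x | x ∈ M0 ∧ x ∈ θ0} = {x | x ∈ M1 ∧ x ∈ θ1})
    (hpow : π '' {x | x ∈ M0 ∧ x ⊆ θ0} = {x | x ∈ M1 ∧ x ⊆ θ1})
    (hmem : ∀ x ∈ ({x | x ∈ M0 ∧ x ∈ θ0} ∪ {x | x ∈ M0 ∧ x ⊆ θ0} : Set ZFSet),
      ∀ y ∈ ({x | x ∈ M0 ∧ x ∈ θ0} ∪ {x | x ∈ M0 ∧ x ⊆ θ0} : Set ZFSet),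
        (x ∈ y ↔ π x ∈ π y)) :
    ∃ σ : ZFSet → ZFSet, Set.BijOn σ M0 M1 ∧
      ∀ x ∈ M0, ∀ y ∈ M0, (x ∈ y ↔ σ x ∈ σ y) := by
  have hπ : ∀ x, ∀ hx : x ∈ M0, x ⊆ θ0 → ∃ hx' : π x ∈ M1,
      classCollapse.{_, u_2} M0 ⟨x, hx⟩ = classCollapse.{_, u_1} M1 ⟨π x, hx'⟩ := by
    intro x
    induction x using ZFSet.inductionOn with | _ x ih
    intro hx hxθ
    have hπx : π x ∈ {x | x ∈ M1 ∧ x ⊆ θ1} := hpow ▸ Set.mem_image_of_mem π ⟨hx, hxθ⟩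
    refine ⟨hπx.1, ZFSet.ext fun y => ?_⟩
    rw [mem_classCollapse, mem_classCollapse]
    constructor
    · rintro ⟨⟨z, hz⟩, hzx, rfl⟩
      obtain ⟨hz', h⟩ := ih z hzx hz (h0.1.1.1 z (hxθ hzx))
      exact ⟨⟨π z, hz'⟩, (hmem z (Or.inl ⟨hz, hxθ hzx⟩) x (Or.inr ⟨hx, hxθ⟩)).1 hzx, h.symm⟩
    · rintro ⟨⟨z', hz'⟩, hzx', rfl⟩
      obtain ⟨z, ⟨hz, hzθ⟩, rfl⟩ : z' ∈ π '' {x | x ∈ M0 ∧ x ∈ θ0} := hord ▸ ⟨hz', hπx.2 hzx'⟩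
      have hzx := (hmem z (Or.inl ⟨hz, hzθ⟩) x (Or.inr ⟨hx, hxθ⟩)).2 hzx'
      obtain ⟨_, h⟩ := ih z hzx hz (h0.1.1.1 z hzθ)
      exact ⟨⟨z, hz⟩, hzx, h⟩
  have heq : Set.range (classCollapse.{_, u_2} M0) = Set.range (classCollapse.{_, u_1} M1) := by
    refine (subset_of_codingAx range_classCollapse_trans range_classCollapse_trans
      (hM0.sat_range_classCollapse_sentence (sat_codingAx_HSet h0))
      (hM1.sat_range_classCollapse_sentence (sat_decodingAx_HSet h1)) ?_).antisymm
      (subset_of_codingAx range_classCollapse_trans range_classCollapse_trans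
      (hM1.sat_range_classCollapse_sentence (sat_codingAx_HSet h1))
      (hM0.sat_range_classCollapse_sentence (sat_decodingAx_HSet h0)) ?_)
    · rintro _ ⟨x, rfl⟩ hA
      obtain ⟨hx', h⟩ := hπ x x.2 (hM0.subset_of_setOfOrds h0 hA)
      exact ⟨_, h.symm⟩
    · rintro _ ⟨⟨y, hy⟩, rfl⟩ hA
      obtain ⟨x, ⟨hx, hxθ⟩, rfl⟩ : y ∈ π '' {x | x ∈ M0 ∧ x ⊆ θ0} :=
        hpow ▸ ⟨hy, hM1.subset_of_setOfOrds h1 hA⟩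
      obtain ⟨_, h⟩ := hπ x hx hxθ
      exact ⟨_, h⟩
  have hex (x : ZFSet) (hx : x ∈ M0) : ∃ y : M1,
      classCollapse.{_, u_1} M1 y = classCollapse.{_, u_2} M0 ⟨x, hx⟩ := by
    rw [← Set.mem_range, ← heq]
    exact Set.mem_range_self _
  choose s hs using hex
  classical
  let σ : ZFSet → ZFSet := fun x => if h : x ∈ M0 then s x h else ∅
  have hσ {x} (hx : x ∈ M0) : σ x = s x hx := dif_pos hx
  refine ⟨σ, ⟨fun x hx => hσ hx ▸ (s x hx).2, fun x hx y hy h => ?_, fun y hy => ?_⟩,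
    fun x hx y hy => ?_⟩
  · rw [hσ hx, hσ hy] at h
    have := hs x hx
    rw [Subtype.ext h, hs y hy] at this
    exact congrArg Subtype.val (classCollapse_injective hM0.sat_extAx this).symm
  · obtain ⟨⟨x, hx⟩, h⟩ : classCollapse.{_, u_1} M1 ⟨y, hy⟩ ∈ Set.range (classCollapse M0) :=
      heq ▸ Set.mem_range_self _
    refine ⟨x, hx, (hσ hx).trans ?_⟩
    exact congrArg Subtype.val (classCollapse_injective hM1.sat_extAx ((hs x hx).trans h))
  · rw [hσ hx, hσ hy, ← classCollapse_mem_iff.{_, u_1} hM1.sat_extAx, hs, hs,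
      classCollapse_mem_iff hM0.sat_extAx]

end GuessingModels
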